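/- Let C ⊂ ℝ² be a planar convex body and r₀ ∈ ∂C a singular point whose tangent angle is {r : (r − r₀, e₁) ≤ 0, (r − r₀, e₂) ≤ 0} with non-collinear unit vectors e₁, e₂, and let e = λ₁e₁ + λ₂e₂ with λ₁ > 0, λ₂ > 0, |e| = 1. Write S_t = ∂C ∩ {r : (r − r₀, e) ≥ −t} as the disjoint union of two arcs S_t¹ (adjacent to the side with normal e₁) and S_t² (adjacent to the side with normal e₂), and let B_t = C ∩ {r : (r − r₀, e) = −t}. Set α = ∠(e₁, e) ∈ (0, π) and β = ∠(e₂, e) ∈ (0, π). Then: (a) sup over regular ξ ∈ S_tⁱ of the deviation of the outward normal n_ξ from e_i tends to zero as t → 0, i.e. inf_{ξ∈S_tⁱ} (n_ξ, e_i) → 1 for i = 1, 2; and (b) the limits lim_{t→0} |S_t¹|/(t sin β), lim_{t→0} |S_t²|/(t sin α), and lim_{t→0} |B_t|/(t sin(π − α − β)) exist, coincide, and lie in (0, +∞). -/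

import Mathlib

open MeasureTheory Set Filter Topology
open scoped RealInnerProductSpace ENNReal

noncomputable section

attribute [local instance] Classical.propDecidable

abbrev E2 := EuclideanSpace ℝ (Fin 2)

/-- A planar convex body: a compact convex set in `ℝ²` with nonempty interior. -/
def IsConvexBody2 (C : Set E2) : Prop :=
  IsCompact C ∧ Convex ℝ C ∧ (interior C).Nonempty

/-- The tangent cone to a convex set `C ⊂ ℝ²` at the point `r₀`. -/
def tanCone2 (C : Set E2) (r₀ : E2) : Set E2 :=
  closure {v : E2 | ∃ c : ℝ, ∃ r ∈ C, 0 ≤ c ∧ v = c • (r - r₀)}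

/-- The angle `{v : ⟪v,e₁⟫ ≤ 0, ⟪v,e₂⟫ ≤ 0}` (as a cone of displacements). -/
def angleCone (e₁ e₂ : E2) : Set E2 := {v : E2 | ⟪v, e₁⟫ ≤ 0 ∧ ⟪v, e₂⟫ ≤ 0}

/-- `n` is an outward unit normal of `C` at `r`. -/
def IsOutwardNormalAt2 (C : Set E2) (r n : E2) : Prop :=
  ‖n‖ = 1 ∧ ∀ x ∈ C, ⟪x - r, n⟫ ≤ 0

/-- `r` is a regular boundary point: the outward unit normal exists and is unique. -/
def IsRegularPt2 (C : Set E2) (r : E2) : Prop :=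
  ∃! n : E2, IsOutwardNormalAt2 C r n

/-- The normal map of `C`, sending a boundary point to an outward unit normal
(the unique one at regular points), and junk value `0` elsewhere. -/
def normalMap2 (C : Set E2) (r : E2) : E2 :=
  if h : ∃ n : E2, IsOutwardNormalAt2 C r n then h.choose else 0

/-- `B_t = C ∩ {r : ⟪r - r₀, e⟫ = -t}`. -/
def Bset2 (C : Set E2) (r₀ e : E2) (t : ℝ) : Set E2 :=
  C ∩ {r : E2 | ⟪r - r₀, e⟫ = -t}

/-- `S_t = ∂C ∩ {r : ⟪r - r₀, e⟫ ≥ -t}`. -/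
def Sset2 (C : Set E2) (r₀ e : E2) (t : ℝ) : Set E2 :=
  frontier C ∩ {r : E2 | ⟪r - r₀, e⟫ ≥ -t}

/-- The normalized measure `ν_t` on `S¹` induced by `S_t`, normalized by the length of
the chord `B_t`. -/
def nuT2 (C : Set E2) (r₀ e : E2) (t : ℝ) : Measure E2 :=
  (μH[1] (Bset2 C r₀ e t))⁻¹ •
    Measure.map (normalMap2 C) (μH[1].restrict (Sset2 C r₀ e t ∩ {r : E2 | IsRegularPt2 C r}))

/-- Weak convergence of the family `ν t` to `ν₀` as `t → 0⁺`. -/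
def WeaklyTendsto2 (ν : ℝ → Measure E2) (ν₀ : Measure E2) : Prop :=
  ∀ f : BoundedContinuousFunction E2 ℝ,
    Tendsto (fun t => ∫ x, f x ∂(ν t)) (𝓝[>] (0 : ℝ)) (𝓝 (∫ x, f x ∂ν₀))


lemma hm_up (S : Set E2) (φ : E2 → ℝ) (m t : ℝ) (hm : 0 < m)
    (h : ∀ x ∈ S, ∀ y ∈ S, m * ‖x - y‖ ≤ |φ x - φ y|)
    (him : ∀ x ∈ S, φ x ∈ Icc 0 t) :
    μH[1] S ≤ ENNReal.ofReal (t / m) := by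
  have hinj : InjOn φ S := by
    intro x hx y hy hxy
    have := h x hx y hy
    rw [hxy, sub_self, abs_zero] at this
    have h2 : ‖x - y‖ ≤ 0 := by
      by_contra hc
      push Not at hc
      nlinarith [mul_pos hm hc]
    exact sub_eq_zero.1 (norm_le_zero_iff.1 h2)
  have hlip : LipschitzOnWith (Real.toNNReal (1 / m)) (Function.invFunOn φ S) (φ '' S) := by
    apply LipschitzOnWith.of_dist_le_mul
    rintro _ ⟨x, hx, rfl⟩ _ ⟨y, hy, rfl⟩
    rw [hinj.leftInvOn_invFunOn hx, hinj.leftInvOn_invFunOn hy, Real.coe_toNNReal _ (by positivity),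
      dist_eq_norm, Real.dist_eq, one_div, inv_mul_eq_div, le_div_iff₀ hm, mul_comm]
    exact h x hx y hy
  have h1 := hlip.hausdorffMeasure_image_le (d := 1) zero_le_one
  rw [hinj.leftInvOn_invFunOn.image_image, hausdorffMeasure_real, ENNReal.rpow_one] at h1
  refine h1.trans ?_
  have h2 : volume (φ '' S) ≤ ENNReal.ofReal t := by
    refine (measure_mono (t := Icc 0 t) ?_).trans (by simp)
    rintro _ ⟨x, hx, rfl⟩
    exact him x hx
  calc _ ≤ ENNReal.ofReal (1 / m) * ENNReal.ofReal t := by gcongr; rfl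
    _ = _ := by rw [← ENNReal.ofReal_mul (by positivity)]; congr 1; ring

lemma hm_low (S : Set E2) (φ : E2 → ℝ) (m p q : ℝ) (hm : 0 < m)
    (h : ∀ x ∈ S, ∀ y ∈ S, |φ x - φ y| ≤ m * ‖x - y‖)
    (him : ∀ s, p < s → s < q → ∃ x ∈ S, φ x = s) :
    ENNReal.ofReal ((q - p) / m) ≤ μH[1] S := by
  have hlip : LipschitzOnWith (Real.toNNReal m) φ S := by
    apply LipschitzOnWith.of_dist_le_mul
    intro x hx y hy
    rw [Real.coe_toNNReal _ hm.le, Real.dist_eq, dist_eq_norm]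
    exact h x hx y hy
  have h1 := hlip.hausdorffMeasure_image_le (d := 1) zero_le_one
  rw [hausdorffMeasure_real, ENNReal.rpow_one] at h1
  have h2 : ENNReal.ofReal (q - p) ≤ volume (φ '' S) := by
    rw [← Real.volume_Ioo]
    apply measure_mono
    intro s hs
    exact him s hs.1 hs.2
  have h3 := h2.trans h1
  rw [ENNReal.ofReal_div_of_pos hm]
  apply ENNReal.div_le_of_le_mul
  rw [mul_comm]; exact h3

/-- From two-sided bounds to a limit. -/
lemma tendsto_of_bounds (F : ℝ → ℝ) (k : ℝ) (lo hi : ℝ → ℝ)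
    (hlo : ContinuousAt lo 0) (hhi : ContinuousAt hi 0) (hlo0 : lo 0 = k) (hhi0 : hi 0 = k)
    (ρ₀ : ℝ) (hρ₀ : 0 < ρ₀)
    (h : ∀ ρ, 0 < ρ → ρ < ρ₀ → ∀ᶠ t in 𝓝[>] (0 : ℝ), lo ρ ≤ F t ∧ F t ≤ hi ρ) :
    Tendsto F (𝓝[>] (0 : ℝ)) (𝓝 k) := by
  have hev : ∀ᶠ ρ in 𝓝[>] (0 : ℝ), 0 < ρ ∧ ρ < ρ₀ := Ioo_mem_nhdsGT hρ₀
  rw [tendsto_order]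
  constructor
  · intro a ha
    have h1 : ∀ᶠ ρ in 𝓝[>] (0 : ℝ), a < lo ρ :=
      (hlo.eventually (lt_mem_nhds (hlo0 ▸ ha))).filter_mono nhdsWithin_le_nhds
    obtain ⟨ρ, h2, h3⟩ := (h1.and hev).exists
    filter_upwards [h ρ h3.1 h3.2] with t ht
    linarith [ht.1]
  · intro a ha
    have h1 : ∀ᶠ ρ in 𝓝[>] (0 : ℝ), hi ρ < a :=
      (hhi.eventually (gt_mem_nhds (hhi0 ▸ ha))).filter_mono nhdsWithin_le_nhds
    obtain ⟨ρ, h2, h3⟩ := (h1.and hev).exists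
    filter_upwards [h ρ h3.1 h3.2] with t ht
    linarith [ht.2]

lemma inner2 (v w : E2) : ⟪v, w⟫ = v 0 * w 0 + v 1 * w 1 := by
  simp [PiLp.inner_apply, Fin.sum_univ_two]; ring

lemma normsq2 (v : E2) : ‖v‖ ^ 2 = v 0 ^ 2 + v 1 ^ 2 := by
  rw [← real_inner_self_eq_norm_sq, inner2]; ring

lemma gram2 (w e e₁ : E2) (h1 : ‖e₁‖ = 1) (h : ‖e‖ = 1) :
    (⟪w, e⟫ - ⟪e₁, e⟫ * ⟪w, e₁⟫) ^ 2 = (1 - ⟪e₁, e⟫ ^ 2) * (‖w‖ ^ 2 - ⟪w, e₁⟫ ^ 2) := by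
  have a1 := normsq2 e₁
  have a2 := normsq2 e
  rw [h1] at a1; rw [h] at a2
  rw [normsq2 w, inner2, inner2, inner2]
  have e1 : w 0 * e 0 + w 1 * e 1 - (e₁ 0 * e 0 + e₁ 1 * e 1) * (w 0 * e₁ 0 + w 1 * e₁ 1)
     = (w 0 * e₁ 1 - w 1 * e₁ 0) * (e 0 * e₁ 1 - e 1 * e₁ 0) := by
    linear_combination (w 0 * e 0 + w 1 * e 1) * a1
  have e2 : 1 - (e₁ 0 * e 0 + e₁ 1 * e 1) ^ 2 = (e 0 * e₁ 1 - e 1 * e₁ 0) ^ 2 := by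
    linear_combination a2 + (e 0 ^2 + e 1 ^2) * a1
  have e3 : w 0 ^ 2 + w 1 ^ 2 - (w 0 * e₁ 0 + w 1 * e₁ 1) ^ 2 = (w 0 * e₁ 1 - w 1 * e₁ 0) ^ 2 := by
    linear_combination (w 0 ^2 + w 1 ^2) * a1
  rw [e1, e2, e3]; ring

/-- If `w` is nearly orthogonal to `e₁` then `|⟪w,e⟫|` is nearly `k ‖w‖`. -/
lemma near_bound (w e e₁ : E2) (h1 : ‖e₁‖ = 1) (h : ‖e‖ = 1) (k ρ : ℝ) (hk : 0 ≤ k)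
    (hk2 : k ^ 2 = 1 - ⟪e₁, e⟫ ^ 2) (hρ : 0 ≤ ρ) (hρ1 : ρ ≤ 1) (hw : |⟪w, e₁⟫| ≤ ρ * ‖w‖) :
    (k - 2 * ρ) * ‖w‖ ≤ |⟪w, e⟫| ∧ |⟪w, e⟫| ≤ (k + 2 * ρ) * ‖w‖ := by
  have hg := gram2 w e e₁ h1 h
  have hN := norm_nonneg w
  set N := ‖w‖
  set u := ⟪w, e₁⟫
  set g := ⟪e₁, e⟫
  have hk1 : k ≤ 1 := by nlinarith [sq_nonneg g]
  have hg1 : |g| ≤ 1 := by rw [abs_le_one_iff_mul_self_le_one]; nlinarith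
  have hgu : |g * u| ≤ ρ * N := by
    rw [abs_mul]
    have := mul_le_mul hg1 hw (abs_nonneg u) zero_le_one
    linarith
  have hu2 : u ^ 2 ≤ (ρ * N) ^ 2 := by
    rw [← sq_abs u]; exact pow_le_pow_left₀ (abs_nonneg u) hw 2
  set z := ⟪w, e⟫ - g * u
  rw [← hk2] at hg
  have hz1 : |z| ≤ k * N := by
    apply abs_le_of_sq_le_sq _ (by positivity)
    rw [hg]
    nlinarith [mul_nonneg (sq_nonneg k) (sq_nonneg u)]
  have hz2 : k * ((1 - ρ) * N) ≤ |z| := by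
    have h1ρ : 0 ≤ 1 - ρ := by linarith
    rw [← sq_le_sq₀ (by positivity) (abs_nonneg z), sq_abs, hg, mul_pow]
    apply mul_le_mul_of_nonneg_left _ (sq_nonneg k)
    nlinarith [mul_nonneg (mul_nonneg hρ h1ρ) (sq_nonneg N)]
  have hkN : k * (ρ * N) ≤ ρ * N := by
    have : 0 ≤ ρ * N := by positivity
    nlinarith
  have e0 : ⟪w, e⟫ = z + g * u := by simp [z]
  rw [e0]
  constructor
  · have := abs_sub_abs_le_abs_sub z (-(g * u))
    rw [abs_neg, sub_neg_eq_add] at this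
    nlinarith
  · have := abs_add_le z (g * u)
    have : 0 ≤ ρ * N := by positivity
    nlinarith

lemma exists_normal (C : Set E2) (hc : Convex ℝ C) (hi : (interior C).Nonempty) (ξ : E2)
    (hξ : ξ ∈ frontier C) : ∃ n, IsOutwardNormalAt2 C ξ n := by
  obtain ⟨f, hf⟩ := geometric_hahn_banach_open_point hc.interior isOpen_interior hξ.2
  set n := (InnerProductSpace.toDual ℝ E2).symm f with hn
  have hfn : ∀ x, f x = ⟪n, x⟫ := fun x => by simp [hn]
  have hn0 : n ≠ 0 := by
    intro h0
    obtain ⟨x, hx⟩ := hi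
    have := hf x hx
    simp [hfn, h0] at this
  have hle : ∀ x ∈ C, f x ≤ f ξ := by
    intro x hx
    have : closure (interior C) ⊆ {x | f x ≤ f ξ} := by
      apply closure_minimal (fun y hy => (hf y hy).le)
      exact isClosed_le f.continuous continuous_const
    apply this
    rw [hc.closure_interior_eq_closure_of_nonempty_interior hi]
    exact subset_closure hx
  have hpos : 0 < ‖n‖ := norm_pos_iff.2 hn0
  refine ⟨‖n‖⁻¹ • n, by rw [norm_smul, norm_inv, norm_norm, inv_mul_cancel₀ hpos.ne'], fun x hx => ?_⟩
  rw [inner_smul_right, real_inner_comm, inner_sub_right, ← hfn, ← hfn]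
  have := hle x hx
  have := inv_pos.2 hpos
  nlinarith

/-- The coordinate `-(l ⟪v,e⟫)`. -/
def co (l : ℝ) (e v : E2) : ℝ := -(l * ⟪v, e⟫)

structure Geo (C : Set E2) (r₀ e₁ e₂ e d₁ d₂ : E2) (l₁ l₂ : ℝ) : Prop where
  cpt : IsCompact C
  cvx : Convex ℝ C
  int : (interior C).Nonempty
  fr : r₀ ∈ frontier C
  n1 : ‖e₁‖ = 1
  n2 : ‖e₂‖ = 1
  ne : e₁ ≠ e₂
  l1 : 0 < l₁
  l2 : 0 < l₂
  he : e = l₁ • e₁ + l₂ • e₂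
  hn : ‖e‖ = 1
  cone : tanCone2 C r₀ = angleCone e₁ e₂
  d11 : co l₁ e₁ d₁ = 0
  d12 : co l₂ e₂ d₁ = 1
  d21 : co l₁ e₁ d₂ = 1
  d22 : co l₂ e₂ d₂ = 0
  exp : ∀ v, v = co l₂ e₂ v • d₁ + co l₁ e₁ v • d₂

lemma co_add (l : ℝ) (e v w : E2) : co l e (v + w) = co l e v + co l e w := by
  simp only [co, inner_add_left]; ring

lemma co_sub (l : ℝ) (e v w : E2) : co l e (v - w) = co l e v - co l e w := by
  simp only [co, inner_sub_left]; ring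

lemma co_smul (l : ℝ) (e v : E2) (c : ℝ) : co l e (c • v) = c * co l e v := by
  simp only [co, real_inner_smul_left]; ring

lemma co_cont (l : ℝ) (e : E2) : Continuous (co l e) := by
  unfold co; fun_prop

namespace Geo

variable {C : Set E2} {r₀ e₁ e₂ e d₁ d₂ : E2} {l₁ l₂ : ℝ}

lemma swap (G : Geo C r₀ e₁ e₂ e d₁ d₂ l₁ l₂) : Geo C r₀ e₂ e₁ e d₂ d₁ l₂ l₁ where
  cpt := G.cpt
  cvx := G.cvx
  int := G.int
  fr := G.fr
  n1 := G.n2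
  n2 := G.n1
  ne := G.ne.symm
  l1 := G.l2
  l2 := G.l1
  he := by rw [G.he, add_comm]
  hn := G.hn
  cone := by rw [G.cone]; ext v; simp [angleCone, and_comm]
  d11 := G.d22
  d12 := G.d21
  d21 := G.d12
  d22 := G.d11
  exp := fun v => by rw [add_comm]; exact G.exp v

lemma co_e (G : Geo C r₀ e₁ e₂ e d₁ d₂ l₁ l₂) (v : E2) :
    co l₂ e₂ v + co l₁ e₁ v = -⟪v, e⟫ := by
  rw [G.he, inner_add_right, real_inner_smul_right, real_inner_smul_right]; simp only [co]; ring

lemma mem (G : Geo C r₀ e₁ e₂ e d₁ d₂ l₁ l₂) : r₀ ∈ C := by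
  have := G.fr.1; rwa [G.cpt.isClosed.closure_eq] at this

lemma in_cone (G : Geo C r₀ e₁ e₂ e d₁ d₂ l₁ l₂) {x : E2} (hx : x ∈ C) :
    ⟪x - r₀, e₁⟫ ≤ 0 ∧ ⟪x - r₀, e₂⟫ ≤ 0 := by
  have : x - r₀ ∈ tanCone2 C r₀ := subset_closure ⟨1, x, hx, zero_le_one, by simp⟩
  rw [G.cone] at this
  exact this

lemma nonneg (G : Geo C r₀ e₁ e₂ e d₁ d₂ l₁ l₂) {x : E2} (hx : x ∈ C) :
    0 ≤ co l₁ e₁ (x - r₀) := by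
  have := (G.in_cone hx).1
  have := G.l1
  unfold co; nlinarith

lemma ray (G : Geo C r₀ e₁ e₂ e d₁ d₂ l₁ l₂) (v : E2) (h1 : 0 < co l₁ e₁ v) (h2 : 0 < co l₂ e₂ v) :
    ∃ s₀ > (0 : ℝ), ∀ s : ℝ, 0 ≤ s → s ≤ s₀ → r₀ + s • v ∈ C := by
  set K := {v : E2 | ∃ c : ℝ, ∃ r ∈ C, 0 ≤ c ∧ v = c • (r - r₀)} with hK
  have hKc : Convex ℝ K := by
    rintro _ ⟨c, r, hr, hc, rfl⟩ _ ⟨c', r', hr', hc', rfl⟩ p q hp hq hpq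
    rcases eq_or_lt_of_le (show 0 ≤ p * c + q * c' by positivity) with h0 | h0
    · have a1 : p * c = 0 := by nlinarith [mul_nonneg hp hc, mul_nonneg hq hc']
      have a2 : q * c' = 0 := by nlinarith [mul_nonneg hp hc, mul_nonneg hq hc']
      exact ⟨0, r, hr, le_rfl, by rw [smul_smul, smul_smul, a1, a2]; simp⟩
    · refine ⟨p * c + q * c', (p * c / (p * c + q * c')) • r + (q * c' / (p * c + q * c')) • r',
        G.cvx hr hr' (by positivity) (by positivity) (by field_simp), h0.le, ?_⟩
      set k := p * c + q * c' with hk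
      have e1 : k • ((p * c / k) • r + (q * c' / k) • r' - r₀) = (p * c) • r + (q * c') • r' - k • r₀ := by
        rw [smul_sub, smul_add, smul_smul, smul_smul, mul_div_cancel₀ _ h0.ne',
          mul_div_cancel₀ _ h0.ne']
      rw [e1, hk]
      module
  have hKi : (interior K).Nonempty := by
    obtain ⟨x, hx⟩ := G.int
    refine ⟨x - r₀, ?_⟩
    rw [mem_interior]
    refine ⟨(fun y => y + r₀) ⁻¹' interior C, ?_, isOpen_interior.preimage (by fun_prop), by simpa⟩
    intro y hy
    exact ⟨1, y + r₀, interior_subset hy, zero_le_one, by simp⟩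
  have hv : v ∈ interior (closure K) := by
    rw [mem_interior]
    refine ⟨{w | 0 < co l₁ e₁ w} ∩ {w | 0 < co l₂ e₂ w}, ?_, ?_, ⟨h1, h2⟩⟩
    · change _ ⊆ tanCone2 C r₀
      rw [G.cone]
      rintro w ⟨w1, w2⟩
      have := G.l1
      have := G.l2
      simp only [co, mem_ofPred_eq] at w1 w2
      constructor
      · by_contra hh
        push Not at hh
        nlinarith [mul_pos G.l1 hh]
      · by_contra hh
        push Not at hh
        nlinarith [mul_pos G.l2 hh]
    · exact (isOpen_lt continuous_const (co_cont _ _)).inter (isOpen_lt continuous_const (co_cont _ _))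
  rw [hKc.interior_closure_eq_interior_of_nonempty_interior hKi] at hv
  obtain ⟨c, r, hr, hc, hvc⟩ := interior_subset hv
  have hc0 : 0 < c := by
    rcases eq_or_lt_of_le hc with h | h
    · rw [hvc, ← h] at h1; simp [co] at h1
    · exact h
  refine ⟨1 / c, by positivity, fun s hs hs' => ?_⟩
  have hsc : s * c ≤ 1 := by rwa [le_div_iff₀ hc0] at hs'
  have : r₀ + s • v = (1 - s * c) • r₀ + (s * c) • r := by rw [hvc]; module
  rw [this]
  exact G.cvx G.mem hr (by linarith) (by positivity) (by ring)

/-- `C` contains a truncated slightly smaller angle. -/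
lemma tri (G : Geo C r₀ e₁ e₂ e d₁ d₂ l₁ l₂) (δ : ℝ) (h0 : 0 < δ) (h1 : δ < 1 / 2) :
    ∃ s₀ > (0 : ℝ), ∀ a b : ℝ, δ * (a + b) ≤ a → δ * (a + b) ≤ b → a + b ≤ s₀ →
      r₀ + (a • d₁ + b • d₂) ∈ C := by
  obtain ⟨s, hs, H⟩ := G.ray ((1 - δ) • d₁ + δ • d₂)
    (by simp only [co_add, co_smul, G.d11, G.d21]; linarith)
    (by simp only [co_add, co_smul, G.d12, G.d22]; linarith)
  obtain ⟨s', hs', H'⟩ := G.ray (δ • d₁ + (1 - δ) • d₂)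
    (by simp only [co_add, co_smul, G.d11, G.d21]; linarith)
    (by simp only [co_add, co_smul, G.d12, G.d22]; linarith)
  set m := min s s'
  have hm : 0 < m := lt_min hs hs'
  refine ⟨m, hm, fun a b ha hb hab => ?_⟩
  have hd : 0 < 1 - 2 * δ := by linarith
  have hd' := hd.ne'
  set p := (a - δ * (a + b)) / (1 - 2 * δ) with hp
  set q := (b - δ * (a + b)) / (1 - 2 * δ) with hq
  have p0 : 0 ≤ p := div_nonneg (by linarith) hd.le
  have q0 : 0 ≤ q := div_nonneg (by linarith) hd.le
  have hpD : p * (1 - 2 * δ) = a - δ * (a + b) := by rw [hp, div_mul_cancel₀ _ hd']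
  have hqD : q * (1 - 2 * δ) = b - δ * (a + b) := by rw [hq, div_mul_cancel₀ _ hd']
  have hpq : p + q = a + b := by
    apply mul_right_cancel₀ hd'
    linear_combination hpD + hqD
  have ea : a = p * (1 - δ) + q * δ := by linear_combination -hpD - δ * hpq
  have eb : b = p * δ + q * (1 - δ) := by linear_combination -hqD - δ * hpq
  have x1 := H m hm.le (min_le_left _ _)
  have x2 := H' m hm.le (min_le_right _ _)
  have key : r₀ + (a • d₁ + b • d₂) = (1 - (p + q) / m) • r₀ +
      ((p / m) • (r₀ + m • ((1 - δ) • d₁ + δ • d₂)) + (q / m) • (r₀ + m • (δ • d₁ + (1 - δ) • d₂))) := by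
    have e1 : (p / m) • (r₀ + m • ((1 - δ) • d₁ + δ • d₂)) =
        (p / m) • r₀ + p • ((1 - δ) • d₁ + δ • d₂) := by
      rw [smul_add, smul_smul, div_mul_cancel₀ _ hm.ne']
    have e2 : (q / m) • (r₀ + m • (δ • d₁ + (1 - δ) • d₂)) =
        (q / m) • r₀ + q • (δ • d₁ + (1 - δ) • d₂) := by
      rw [smul_add, smul_smul, div_mul_cancel₀ _ hm.ne']
    rw [e1, e2, add_div]
    nth_rewrite 1 [ea]
    nth_rewrite 1 [eb]
    module
  have h3 : (p + q) / m ≤ 1 := by rw [div_le_one hm]; linarith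
  rw [key, ← add_assoc]
  have hc := G.cvx.sum_mem (t := Finset.univ) (w := ![1 - (p + q) / m, p / m, q / m])
    (z := ![r₀, r₀ + m • ((1 - δ) • d₁ + δ • d₂), r₀ + m • (δ • d₁ + (1 - δ) • d₂)]) 
    (by intro i _; fin_cases i <;> simp <;> first | positivity | assumption)
    (by simp [Fin.sum_univ_three]; ring)
    (by intro i _; fin_cases i <;> simp [-smul_add]; exacts [G.mem, x1, x2])
  simpa [Fin.sum_univ_three, -smul_add] using hc

/-- Frontier points near `r₀` on side 1 are close to that side. -/
lemma near_side (G : Geo C r₀ e₁ e₂ e d₁ d₂ l₁ l₂) (δ s₀ : ℝ) (h0 : 0 < δ) (h1 : δ < 1 / 2)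
    (T : ∀ a b : ℝ, δ * (a + b) ≤ a → δ * (a + b) ≤ b → a + b ≤ s₀ →
      r₀ + (a • d₁ + b • d₂) ∈ C) (ξ : E2) (hξ : ξ ∈ frontier C)
    (hab : co l₁ e₁ (ξ - r₀) ≤ co l₂ e₂ (ξ - r₀))
    (hpos : 0 < co l₂ e₂ (ξ - r₀) + co l₁ e₁ (ξ - r₀))
    (hs : co l₂ e₂ (ξ - r₀) + co l₁ e₁ (ξ - r₀) < s₀) :
    co l₁ e₁ (ξ - r₀) ≤ δ * (co l₂ e₂ (ξ - r₀) + co l₁ e₁ (ξ - r₀)) := by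
  by_contra hc
  push Not at hc
  apply hξ.2
  have c1 : Continuous fun x : E2 => co l₁ e₁ (x - r₀) := (co_cont _ _).comp (by fun_prop)
  have c2 : Continuous fun x : E2 => co l₂ e₂ (x - r₀) := (co_cont _ _).comp (by fun_prop)
  rw [mem_interior]
  refine ⟨{x | δ * (co l₂ e₂ (x - r₀) + co l₁ e₁ (x - r₀)) < co l₁ e₁ (x - r₀)} ∩
    {x | δ * (co l₂ e₂ (x - r₀) + co l₁ e₁ (x - r₀)) < co l₂ e₂ (x - r₀)} ∩
    {x | co l₂ e₂ (x - r₀) + co l₁ e₁ (x - r₀) < s₀}, ?_, ?_, ⟨⟨hc, ?_⟩, hs⟩⟩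
  · rintro x ⟨⟨x1, x2⟩, x3⟩
    have := T _ _ (le_of_lt x2) (le_of_lt x1) (le_of_lt x3)
    rw [← G.exp] at this
    simpa using this
  · exact ((isOpen_lt (by fun_prop) c1).inter (isOpen_lt (by fun_prop) c2)).inter
      (isOpen_lt (by fun_prop) (by fun_prop))
  · simp only [mem_ofPred_eq]; nlinarith

lemma pos_of_ne (G : Geo C r₀ e₁ e₂ e d₁ d₂ l₁ l₂) (ξ : E2) (hξ : ξ ∈ C) (hne : ξ ≠ r₀) :
    0 < co l₂ e₂ (ξ - r₀) + co l₁ e₁ (ξ - r₀) := by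
  have h1 := G.nonneg hξ
  have h2 := G.swap.nonneg hξ
  by_contra hc
  push Not at hc
  have e1 : co l₁ e₁ (ξ - r₀) = 0 := by linarith
  have e2 : co l₂ e₂ (ξ - r₀) = 0 := by linarith
  have := G.exp (ξ - r₀)
  rw [e1, e2] at this
  simp at this
  exact hne (sub_eq_zero.1 this)

lemma unit_close (G : Geo C r₀ e₁ e₂ e d₁ d₂ l₁ l₂) (ε : ℝ) (hε : 0 < ε) :
    ∃ η > 0, ∀ n : E2, ‖n‖ = 1 → |⟪d₁, n⟫| ≤ η → ⟪d₂, n⟫ ≤ η → 1 - ε < ⟪n, e₁⟫ := by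
  set K := Metric.sphere (0 : E2) 1 ∩ {n | ⟪n, e₁⟫ ≤ 1 - ε}
  have hK : IsCompact K := (isCompact_sphere 0 1).inter_right
    (isClosed_le (by fun_prop) continuous_const)
  rcases K.eq_empty_or_nonempty with hE | hE
  · refine ⟨1, one_pos, fun n hn _ _ => ?_⟩
    by_contra hc
    push Not at hc
    have : n ∈ K := ⟨by simpa using hn, hc⟩
    rw [hE] at this
    exact this
  obtain ⟨m, ⟨hm1, hm2⟩, hmin⟩ := hK.exists_isMinOn hE
    (f := fun n => max |⟪d₁, n⟫| ⟪d₂, n⟫) (by fun_prop)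
  have hm1 : ‖m‖ = 1 := by simpa using hm1
  have hpos : 0 < max |⟪d₁, m⟫| ⟪d₂, m⟫ := by
    by_contra hc
    push Not at hc
    have hx : ⟪d₁, m⟫ = 0 := abs_nonpos_iff.1 ((le_max_left _ _).trans hc)
    have hy : ⟪d₂, m⟫ ≤ 0 := (le_max_right _ _).trans hc
    -- `m = c e₁`
    have hee : (⟪e₁, e₁⟫ : ℝ) = 1 := by rw [real_inner_self_eq_norm_sq, G.n1]; norm_num
    have hmm : (⟪m, m⟫ : ℝ) = 1 := by rw [real_inner_self_eq_norm_sq, hm1]; norm_num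
    have hd : ⟪d₁, e₁⟫ = 0 := by
      have h := G.d11
      have h' := G.l1.ne'
      simpa [co, h'] using h
    have hd2 : ⟪d₂, e₁⟫ < 0 := by
      have h := G.d21
      have h' := G.l1
      unfold co at h
      by_contra hc
      push Not at hc
      nlinarith [mul_nonneg h'.le hc]
    set c := ⟪m, e₁⟫ with hcdef
    have hw := G.exp (m - c • e₁)
    have hw1 : co l₁ e₁ (m - c • e₁) = 0 := by
      simp only [co, inner_sub_left, real_inner_smul_left, hee, ← hcdef]; ring
    rw [hw1, zero_smul, add_zero] at hw
    have hw2 : (⟪m - c • e₁, m - c • e₁⟫ : ℝ) = 0 := by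
      nth_rewrite 1 [hw]
      rw [real_inner_smul_left, inner_sub_right, real_inner_smul_right, hx, hd]; ring
    have hmc : m = c • e₁ := sub_eq_zero.1 (inner_self_eq_zero.1 hw2)
    have hc2 : c * c = 1 := by
      rw [hmc, real_inner_smul_left, real_inner_smul_right, hee] at hmm
      linarith
    have hc0 : 0 ≤ c := by
      rw [hmc, real_inner_smul_right] at hy
      by_contra h
      push Not at h
      nlinarith [mul_pos_of_neg_of_neg h hd2]
    have : c = 1 := by nlinarith
    have : c ≤ 1 - ε := hm2
    linarith
  refine ⟨max |⟪d₁, m⟫| ⟪d₂, m⟫ / 2, by positivity, fun n hn h1 h2 => ?_⟩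
  by_contra hc
  push Not at hc
  have : n ∈ K := ⟨by simpa using hn, hc⟩
  have h3 : max |⟪d₁, m⟫| ⟪d₂, m⟫ ≤ max |⟪d₁, n⟫| ⟪d₂, n⟫ := hmin this
  have := max_le h1 h2
  linarith

lemma normals (G : Geo C r₀ e₁ e₂ e d₁ d₂ l₁ l₂) (ε : ℝ) (hε : 0 < ε) :
    ∃ t₀ > 0, ∀ ξ ∈ frontier C, ξ ≠ r₀ → co l₁ e₁ (ξ - r₀) ≤ co l₂ e₂ (ξ - r₀) →
      -⟪ξ - r₀, e⟫ ≤ t₀ → ∀ n, IsOutwardNormalAt2 C ξ n → 1 - ε < ⟪n, e₁⟫ := by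
  obtain ⟨η, hη, H⟩ := G.unit_close ε hε
  set M := max (max ‖d₁‖ ‖d₂‖) 1
  have hM : 1 ≤ M := le_max_right _ _
  have hM1 : ‖d₁‖ ≤ M := (le_max_left _ _).trans (le_max_left _ _)
  have hM2 : ‖d₂‖ ≤ M := (le_max_right _ _).trans (le_max_left _ _)
  obtain ⟨δ, hδ0, hδ⟩ : ∃ δ > 0, δ < min (1 / 2) (η / (4 * M)) := exists_between (by positivity)
  have hδ1 : δ < 1 / 2 := hδ.trans_le (min_le_left _ _)
  have hδ2 : 4 * δ * M ≤ η := by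
    have := (hδ.trans_le (min_le_right _ _)).le
    rw [le_div_iff₀ (by positivity)] at this
    linarith
  obtain ⟨s₀, hs₀, T⟩ := G.tri δ hδ0 hδ1
  refine ⟨δ * s₀, by positivity, fun ξ hξ hne hab ht n hn => ?_⟩
  have hξC : ξ ∈ C := by
    have := hξ.1; rwa [G.cpt.isClosed.closure_eq] at this
  have hpos := G.pos_of_ne ξ hξC hne
  have hb0 := G.nonneg hξC
  rw [← G.co_e] at ht
  have hside := G.near_side δ s₀ hδ0 hδ1 T ξ hξ hab hpos (by nlinarith)
  have hexp := G.exp (ξ - r₀)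
  have P0 := hn.2 r₀ G.mem
  have P1 := hn.2 _ (T (s₀ * (1 - δ)) (s₀ * δ) (by nlinarith) (by nlinarith) (by nlinarith))
  have P2 := hn.2 _ (T (s₀ * δ) (s₀ * (1 - δ)) (by nlinarith) (by nlinarith) (by nlinarith))
  have hx : |⟪d₁, n⟫| ≤ M := (abs_real_inner_le_norm _ _).trans (by rw [hn.1]; linarith)
  have hy : |⟪d₂, n⟫| ≤ M := (abs_real_inner_le_norm _ _).trans (by rw [hn.1]; linarith)
  set a := co l₂ e₂ (ξ - r₀)
  set b := co l₁ e₁ (ξ - r₀)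
  have hξn : ⟪ξ - r₀, n⟫ = a * ⟪d₁, n⟫ + b * ⟪d₂, n⟫ := by
    rw [hexp, inner_add_left, real_inner_smul_left, real_inner_smul_left]
  have Q0 : 0 ≤ a * ⟪d₁, n⟫ + b * ⟪d₂, n⟫ := by
    rw [← hξn, ← neg_sub, inner_neg_left]; linarith
  have aux : ∀ p q : ℝ, ⟪r₀ + (p • d₁ + q • d₂) - ξ, n⟫ =
      p * ⟪d₁, n⟫ + q * ⟪d₂, n⟫ - (a * ⟪d₁, n⟫ + b * ⟪d₂, n⟫) := by
    intro p q
    rw [← hξn, show r₀ + (p • d₁ + q • d₂) - ξ = p • d₁ + q • d₂ - (ξ - r₀) by abel,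
      inner_sub_left, inner_add_left, real_inner_smul_left, real_inner_smul_left]
  rw [aux] at P1 P2
  obtain ⟨hx1, hx2⟩ := abs_le.1 hx
  obtain ⟨hy1, hy2⟩ := abs_le.1 hy
  set x := ⟪d₁, n⟫
  set y := ⟪d₂, n⟫
  have ha0 : 0 ≤ a := by linarith
  have hup : a * x + b * y ≤ δ * s₀ * M := by
    have := mul_le_mul_of_nonneg_left hx2 ha0
    have := mul_le_mul_of_nonneg_left hy2 hb0
    have := mul_le_mul_of_nonneg_right ht (show 0 ≤ M by linarith)
    linarith
  have R1 : (1 - δ) * x + δ * y ≤ δ * M := by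
    have : s₀ * ((1 - δ) * x + δ * y) ≤ s₀ * (δ * M) := by linarith
    exact le_of_mul_le_mul_left this hs₀
  have R2 : δ * x + (1 - δ) * y ≤ δ * M := by
    have : s₀ * (δ * x + (1 - δ) * y) ≤ s₀ * (δ * M) := by linarith
    exact le_of_mul_le_mul_left this hs₀
  have dy := mul_le_mul_of_nonneg_left hy1 hδ0.le
  have dx := mul_le_mul_of_nonneg_left hx1 hδ0.le
  have hdM : 0 < δ * M := by positivity
  have X1 : x ≤ 4 * δ * M := by
    by_contra hc
    push Not at hc
    nlinarith
  have Y1 : y ≤ 4 * δ * M := by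
    by_contra hc
    push Not at hc
    nlinarith
  have X2 : -(4 * δ * M) ≤ x := by
    by_contra hc
    push Not at hc
    have h1 : b * y ≤ δ * (a + b) * M :=
      (mul_le_mul_of_nonneg_left hy2 hb0).trans (mul_le_mul_of_nonneg_right hside (by linarith))
    have h2 : a * x ≤ (a + b) / 2 * x := by nlinarith
    nlinarith [mul_pos hpos hdM]
  exact H n hn.1 (abs_le.2 ⟨by linarith, by linarith⟩) (by linarith)

end Geo

namespace Geo

variable {C : Set E2} {r₀ e₁ e₂ e d₁ d₂ : E2} {l₁ l₂ : ℝ}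

lemma exists_pt (G : Geo C r₀ e₁ e₂ e d₁ d₂ l₁ l₂) :
    ∃ s₀ > (0 : ℝ), ∀ τ, 0 < τ → τ ≤ s₀ → ∃ ξ ∈ frontier C,
      co l₁ e₁ (ξ - r₀) < co l₂ e₂ (ξ - r₀) ∧ -⟪ξ - r₀, e⟫ = τ := by
  obtain ⟨s₀, hs₀, T⟩ := G.tri (1 / 4) (by norm_num) (by norm_num)
  refine ⟨s₀, hs₀, fun τ hτ hτs => ?_⟩
  set B := C ∩ {x | -⟪x - r₀, e⟫ = τ} with hB
  have hBc : IsCompact B := G.cpt.inter_right (isClosed_eq (by fun_prop) (by fun_prop))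
  have hx0 := T (3 / 4 * τ) (1 / 4 * τ) (by linarith) (by linarith) (by linarith)
  set x₀ := r₀ + ((3 / 4 * τ) • d₁ + (1 / 4 * τ) • d₂) with hx₀
  have c1 : co l₁ e₁ (x₀ - r₀) = 1 / 4 * τ := by
    simp [hx₀, co_add, co_smul, G.d11, G.d21]
  have c2 : co l₂ e₂ (x₀ - r₀) = 3 / 4 * τ := by
    simp [hx₀, co_add, co_smul, G.d12, G.d22]
  have hxB : x₀ ∈ B := ⟨hx0, by
    change -⟪x₀ - r₀, e⟫ = τ
    rw [← G.co_e, c1, c2]; ring⟩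
  obtain ⟨ξ, hξ, hmin⟩ := hBc.exists_isMinOn ⟨_, hxB⟩ (f := fun x => co l₁ e₁ (x - r₀))
    ((co_cont _ _).comp (by fun_prop)).continuousOn
  have hb : co l₁ e₁ (ξ - r₀) ≤ 1 / 4 * τ := by rw [← c1]; exact hmin hxB
  have hτ' : -⟪ξ - r₀, e⟫ = τ := hξ.2
  refine ⟨ξ, ?_, ?_, hτ'⟩
  · refine ⟨subset_closure hξ.1, fun hint => ?_⟩
    have hcont : Continuous fun η : ℝ => ξ + η • (d₁ - d₂) := by fun_prop
    have : ∀ᶠ η in 𝓝[>] (0 : ℝ), ξ + η • (d₁ - d₂) ∈ interior C := by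
      apply Filter.Eventually.filter_mono nhdsWithin_le_nhds
      apply hcont.continuousAt.eventually_mem
      apply isOpen_interior.mem_nhds
      simpa using hint
    obtain ⟨η, h1, h2⟩ := (this.and self_mem_nhdsWithin).exists
    have h2 : 0 < η := h2
    have e1 : co l₁ e₁ (ξ + η • (d₁ - d₂) - r₀) = co l₁ e₁ (ξ - r₀) - η := by
      rw [add_sub_right_comm, co_add, co_smul, co_sub _ _ d₁ d₂, G.d11, G.d21]; ring
    have e2 : co l₂ e₂ (ξ + η • (d₁ - d₂) - r₀) = co l₂ e₂ (ξ - r₀) + η := by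
      rw [add_sub_right_comm, co_add, co_smul, co_sub _ _ d₁ d₂, G.d12, G.d22]; ring
    have hin : ξ + η • (d₁ - d₂) ∈ B := ⟨interior_subset h1, by
      change -⟪ξ + η • (d₁ - d₂) - r₀, e⟫ = τ
      rw [← G.co_e, e1, e2, ← hτ', ← G.co_e]; ring⟩
    have : co l₁ e₁ (ξ - r₀) ≤ co l₁ e₁ (ξ + η • (d₁ - d₂) - r₀) := hmin hin
    linarith
  · rw [← G.co_e] at hτ'
    linarith

lemma side (G : Geo C r₀ e₁ e₂ e d₁ d₂ l₁ l₂) (k : ℝ) (hk : 0 < k)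
    (hk2 : k ^ 2 = 1 - ⟪e₁, e⟫ ^ 2) (S : ℝ → Set E2)
    (hS1 : ∀ t, 0 < t → ∀ x ∈ S t, x ∈ Sset2 C r₀ e t ∧ co l₁ e₁ (x - r₀) ≤ co l₂ e₂ (x - r₀))
    (hS2 : ∀ t, 0 < t → ∀ x ∈ Sset2 C r₀ e t, co l₁ e₁ (x - r₀) < co l₂ e₂ (x - r₀) → x ∈ S t) :
    Tendsto (fun t => (μH[1] (S t)).toReal / t) (𝓝[>] (0 : ℝ)) (𝓝 (1 / k)) := by
  apply tendsto_of_bounds _ _ (fun ρ => 1 / (k + 2 * ρ)) (fun ρ => 1 / (k - 2 * ρ))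
    (by apply ContinuousAt.div <;> first | fun_prop | simpa using hk.ne')
    (by apply ContinuousAt.div <;> first | fun_prop | simpa using hk.ne')
    (by simp) (by simp) (min 1 (k / 2)) (by positivity)
  intro ρ hρ hρ'
  have hρ1 : ρ < 1 := hρ'.trans_le (min_le_left _ _)
  have hρk : 2 * ρ < k := by linarith [hρ'.trans_le (min_le_right 1 (k / 2))]
  obtain ⟨t₀, ht₀, H⟩ := G.normals (ρ ^ 2 / 2) (by positivity)
  obtain ⟨s₀, hs₀, P⟩ := G.exists_pt
  have hev : ∀ᶠ t in 𝓝[>] (0 : ℝ), 0 < t ∧ t < min t₀ s₀ := Ioo_mem_nhdsGT (by positivity)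
  filter_upwards [hev] with t ht
  obtain ⟨ht, htm⟩ := ht
  have htt : t < t₀ := htm.trans_le (min_le_left _ _)
  have hts : t < s₀ := htm.trans_le (min_le_right _ _)
  have hnor : ∀ x ∈ S t, x ∈ C ∧ ∃ n, IsOutwardNormalAt2 C x n ∧ ‖n - e₁‖ ≤ ρ := by
    intro x hx
    obtain ⟨hxS, hxc⟩ := hS1 t ht x hx
    have hxC : x ∈ C := by
      have := hxS.1.1; rwa [G.cpt.isClosed.closure_eq] at this
    refine ⟨hxC, ?_⟩
    by_cases hxr : x = r₀
    · subst hxr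
      exact ⟨e₁, ⟨G.n1, fun y hy => (G.in_cone hy).1⟩, by simpa using hρ.le⟩
    · obtain ⟨n, hn⟩ := exists_normal C G.cvx G.int x hxS.1
      refine ⟨n, hn, ?_⟩
      have hh : ⟪x - r₀, e⟫ ≥ -t := hxS.2
      have h1 := H x hxS.1 hxr hxc (by linarith) n hn
      have h2 := norm_sub_sq_real n e₁
      rw [hn.1, G.n1] at h2
      apply le_of_sq_le_sq _ hρ.le
      nlinarith
  have hw : ∀ x ∈ S t, ∀ y ∈ S t, |⟪x - y, e₁⟫| ≤ ρ * ‖x - y‖ := by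
    have one : ∀ x ∈ S t, ∀ y ∈ S t, ⟪x - y, e₁⟫ ≤ ρ * ‖x - y‖ := by
      intro x hx y hy
      obtain ⟨n, hn, hn1⟩ := (hnor y hy).2
      have h1 := hn.2 x (hnor x hx).1
      have h2 := real_inner_le_norm (x - y) (e₁ - n)
      rw [norm_sub_rev e₁ n, inner_sub_right] at h2
      have h3 := mul_le_mul_of_nonneg_left hn1 (norm_nonneg (x - y))
      linarith
    intro x hx y hy
    have h1 := one x hx y hy
    have h2 := one y hy x hx
    rw [norm_sub_rev, ← neg_sub x y, inner_neg_left] at h2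
    exact abs_le.2 ⟨by linarith, h1⟩
  have hφ : ∀ x y : E2, |-⟪x - r₀, e⟫ - -⟪y - r₀, e⟫| = |⟪x - y, e⟫| := by
    intro x y
    rw [← abs_neg ⟪x - y, e⟫]
    congr 1
    simp only [inner_sub_left]; ring
  have nb := fun x hx y hy => near_bound (x - y) e e₁ G.n1 G.hn k ρ hk.le hk2 hρ.le hρ1.le
    (hw x hx y hy)
  have up := hm_up (S t) (fun x => -⟪x - r₀, e⟫) (k - 2 * ρ) t (by linarith)
    (fun x hx y hy => by rw [hφ]; exact (nb x hx y hy).1)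
    (fun x hx => by
      have hh : ⟪x - r₀, e⟫ ≥ -t := (hS1 t ht x hx).1.2
      have h1 := G.nonneg (hnor x hx).1
      have h2 := G.swap.nonneg (hnor x hx).1
      have h3 := G.co_e (x - r₀)
      constructor <;> linarith)
  have low := hm_low (S t) (fun x => -⟪x - r₀, e⟫) (k + 2 * ρ) 0 t (by linarith)
    (fun x hx y hy => by rw [hφ]; exact (nb x hx y hy).2)
    (fun s hs hs' => by
      obtain ⟨ξ, h1, h2, h3⟩ := P s hs (by linarith)
      refine ⟨ξ, hS2 t ht ξ ⟨h1, ?_⟩ h2, h3⟩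
      change ⟪ξ - r₀, e⟫ ≥ -t
      linarith)
  have hfin : μH[1] (S t) ≠ ⊤ := (up.trans_lt ENNReal.ofReal_lt_top).ne
  have u := ENNReal.toReal_le_of_le_ofReal (div_nonneg ht.le (by linarith)) up
  have l := (ENNReal.ofReal_le_iff_le_toReal hfin).1 low
  rw [sub_zero] at l
  constructor
  · rw [le_div_iff₀ ht]; calc _ = t / (k + 2 * ρ) := by ring
      _ ≤ _ := l
  · rw [div_le_iff₀ ht]; calc _ ≤ _ := u
      _ = _ := by ring

lemma chord (G : Geo C r₀ e₁ e₂ e d₁ d₂ l₁ l₂) :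
    Tendsto (fun t => (μH[1] (Bset2 C r₀ e t)).toReal / t) (𝓝[>] (0 : ℝ)) (𝓝 ‖d₁ - d₂‖) := by
  have hD : 0 < ‖d₁ - d₂‖ := by
    rw [norm_pos_iff, sub_ne_zero]
    intro h
    have h1 := G.d11
    rw [h, G.d21] at h1
    norm_num at h1
  set D := ‖d₁ - d₂‖ with hDdef
  apply tendsto_of_bounds _ _ (fun ρ => (1 - 2 * ρ) * D) (fun _ => D)
    (by fun_prop) (by fun_prop) (by simp) (by simp) (1 / 2) (by positivity)
  intro ρ hρ hρ'
  obtain ⟨s₀, hs₀, T⟩ := G.tri ρ hρ hρ'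
  have hev : ∀ᶠ t in 𝓝[>] (0 : ℝ), 0 < t ∧ t < s₀ := Ioo_mem_nhdsGT hs₀
  filter_upwards [hev] with t ht
  obtain ⟨ht, hts⟩ := ht
  have hsum : ∀ x ∈ Bset2 C r₀ e t, co l₂ e₂ (x - r₀) + co l₁ e₁ (x - r₀) = t := by
    intro x hx
    have hh : ⟪x - r₀, e⟫ = -t := hx.2
    rw [G.co_e, hh, neg_neg]
  have hφ : ∀ x ∈ Bset2 C r₀ e t, ∀ y ∈ Bset2 C r₀ e t,
      |co l₂ e₂ (x - r₀) - co l₂ e₂ (y - r₀)| = 1 / D * ‖x - y‖ := by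
    intro x hx y hy
    have h1 := hsum x hx
    have h2 := hsum y hy
    have h3 : x - y = (co l₂ e₂ (x - r₀) - co l₂ e₂ (y - r₀)) • (d₁ - d₂) := by
      have h4 := G.exp (x - y)
      have e0 : x - y = (x - r₀) - (y - r₀) := by abel
      have e1 : co l₁ e₁ (x - y) = -(co l₂ e₂ (x - r₀) - co l₂ e₂ (y - r₀)) := by
        rw [e0, co_sub]; linarith
      have e2 : co l₂ e₂ (x - y) = (co l₂ e₂ (x - r₀) - co l₂ e₂ (y - r₀)) := by
        rw [e0, co_sub]
      rw [e1, e2] at h4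
      rw [h4]; module
    have h5 : ‖x - y‖ = |co l₂ e₂ (x - r₀) - co l₂ e₂ (y - r₀)| * D := by
      conv_lhs => rw [h3]
      rw [norm_smul, Real.norm_eq_abs]
    rw [h5]; field_simp
  have up := hm_up (Bset2 C r₀ e t) (fun x => co l₂ e₂ (x - r₀)) (1 / D) t (by positivity)
    (fun x hx y hy => (hφ x hx y hy).ge)
    (fun x hx => by
      have h1 := G.nonneg hx.1
      have h2 := G.swap.nonneg hx.1
      have h3 := hsum x hx
      constructor <;> linarith)
  have low := hm_low (Bset2 C r₀ e t) (fun x => co l₂ e₂ (x - r₀)) (1 / D) (ρ * t) ((1 - ρ) * t)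
    (by positivity)
    (fun x hx y hy => (hφ x hx y hy).le)
    (fun s hs hs' => by
      have hm := T s (t - s) (by linarith) (by linarith) (by linarith)
      refine ⟨_, ⟨hm, ?_⟩, ?_⟩
      · change ⟪_, e⟫ = -t
        rw [add_sub_cancel_left, ← neg_neg ⟪_, e⟫, ← G.co_e]
        simp only [co_add, co_smul, G.d11, G.d12, G.d21, G.d22]; ring
      · simp only [add_sub_cancel_left, co_add, co_smul, G.d12, G.d22]; ring)
  have hfin : μH[1] (Bset2 C r₀ e t) ≠ ⊤ := (up.trans_lt ENNReal.ofReal_lt_top).ne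
  have u := ENNReal.toReal_le_of_le_ofReal (by positivity) up
  have l := (ENNReal.ofReal_le_iff_le_toReal hfin).1 low
  constructor
  · rw [le_div_iff₀ ht]; calc _ = ((1 - ρ) * t - ρ * t) / (1 / D) := by field_simp; ring
      _ ≤ _ := l
  · rw [div_le_iff₀ ht]; calc _ ≤ _ := u
      _ = _ := by field_simp

lemma not_reg (G : Geo C r₀ e₁ e₂ e d₁ d₂ l₁ l₂) : ¬ IsRegularPt2 C r₀ := by
  rintro ⟨n, _, hn⟩
  have h1 := hn e₁ ⟨G.n1, fun y hy => (G.in_cone hy).1⟩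
  have h2 := hn e₂ ⟨G.n2, fun y hy => (G.in_cone hy).2⟩
  exact G.ne (h1.trans h2.symm)

end Geo

lemma zero_of_orth (e₁ e₂ z : E2) (h1 : ‖e₁‖ = 1) (h2 : ‖e₂‖ = 1) (hc : 0 < 1 - ⟪e₁, e₂⟫ ^ 2)
    (z1 : ⟪z, e₁⟫ = 0) (z2 : ⟪z, e₂⟫ = 0) : z = 0 := by
  have := gram2 z e₂ e₁ h1 h2
  rw [z1, z2] at this
  have h3 : ‖z‖ ^ 2 = 0 := by
    have : (1 - ⟪e₁, e₂⟫ ^ 2) * ‖z‖ ^ 2 = 0 := by linarith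
    rcases mul_eq_zero.1 this with h | h
    · linarith
    · exact h
  simpa using h3

open InnerProductGeometry in
/-- **Remark 1 of the paper (2D case).** Near a singular boundary point of a planar
convex body, `S_t` splits into two arcs `S_t¹`, `S_t²` such that (a) the normals at
regular points of `S_tⁱ` deviate from `e_i` by an amount tending to `0` as `t → 0⁺`,
and (b) the sine law holds: the limits `|S_t¹|/(t sin β)`, `|S_t²|/(t sin α)` and
`|B_t|/(t sin(π−α−β))` exist, coincide, and are finite and positive, where
`α = ∠(e₁,e)` and `β = ∠(e₂,e)`. -/
theorem planar_sine_law
    (C : Set E2) (r₀ e₁ e₂ e : E2) (lam₁ lam₂ : ℝ)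
    (hC : IsConvexBody2 C) (hr₀ : r₀ ∈ frontier C)
    (he₁ : ‖e₁‖ = 1) (he₂ : ‖e₂‖ = 1) (hne : e₁ ≠ e₂) (hne' : e₁ ≠ -e₂)
    (hcone : tanCone2 C r₀ = angleCone e₁ e₂)
    (hl₁ : 0 < lam₁) (hl₂ : 0 < lam₂) (he : e = lam₁ • e₁ + lam₂ • e₂) (hnorm : ‖e‖ = 1) :
    ∃ S1 S2 : ℝ → Set E2,
      (∀ t : ℝ, 0 < t →
        S1 t ∪ S2 t = Sset2 C r₀ e t ∧ Disjoint (S1 t) (S2 t)) ∧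
      (∀ ε : ℝ, 0 < ε → ∃ t₀ > (0 : ℝ), ∀ t : ℝ, 0 < t → t < t₀ →
        (∀ ξ ∈ S1 t, IsRegularPt2 C ξ → ∀ n : E2, IsOutwardNormalAt2 C ξ n →
          1 - ε < ⟪n, e₁⟫) ∧
        (∀ ξ ∈ S2 t, IsRegularPt2 C ξ → ∀ n : E2, IsOutwardNormalAt2 C ξ n →
          1 - ε < ⟪n, e₂⟫)) ∧
      ∃ L : ℝ, 0 < L ∧
        Tendsto (fun t => (μH[1] (S1 t)).toReal / (t * Real.sin (angle e₂ e)))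
          (𝓝[>] (0 : ℝ)) (𝓝 L) ∧
        Tendsto (fun t => (μH[1] (S2 t)).toReal / (t * Real.sin (angle e₁ e)))
          (𝓝[>] (0 : ℝ)) (𝓝 L) ∧
        Tendsto (fun t => (μH[1] (Bset2 C r₀ e t)).toReal /
            (t * Real.sin (Real.pi - angle e₁ e - angle e₂ e)))
          (𝓝[>] (0 : ℝ)) (𝓝 L) := by
  have i11 : (⟪e₁, e₁⟫ : ℝ) = 1 := by rw [real_inner_self_eq_norm_sq, he₁]; norm_num
  have i22 : (⟪e₂, e₂⟫ : ℝ) = 1 := by rw [real_inner_self_eq_norm_sq, he₂]; norm_num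
  have hcc : 0 < 1 - ⟪e₁, e₂⟫ ^ 2 := by
    have h1 := abs_real_inner_le_norm e₁ e₂
    rw [he₁, he₂, mul_one, abs_le] at h1
    have h2 : (⟪e₁, e₂⟫ : ℝ) ≠ 1 := fun h => hne ((inner_eq_one_iff_of_norm_eq_one he₁ he₂).1 h)
    have h3 : (⟪e₁, e₂⟫ : ℝ) ≠ -1 :=
      fun h => hne' ((inner_eq_neg_one_iff_of_norm_eq_one he₁ he₂).1 h)
    have h4 := lt_of_le_of_ne h1.2 h2
    have h5 := lt_of_le_of_ne h1.1 h3.symm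
    nlinarith
  have hz := zero_of_orth e₁ e₂
  have hmain : ‖e‖ ^ 2 = lam₁ ^ 2 + lam₂ ^ 2 + 2 * lam₁ * lam₂ * ⟪e₁, e₂⟫ := by
    rw [he, ← real_inner_self_eq_norm_sq]
    simp only [inner_add_left, inner_add_right, real_inner_smul_left, real_inner_smul_right, i11, i22,
      real_inner_comm e₁ e₂]
    ring
  have i21 : (⟪e₂, e₁⟫ : ℝ) = ⟪e₁, e₂⟫ := real_inner_comm _ _
  have c1 : (⟪e₁, e⟫ : ℝ) = lam₁ + lam₂ * ⟪e₁, e₂⟫ := by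
    rw [he, inner_add_right, real_inner_smul_right, real_inner_smul_right, i11]; ring
  have c2 : (⟪e₂, e⟫ : ℝ) = lam₁ * ⟪e₁, e₂⟫ + lam₂ := by
    rw [he, inner_add_right, real_inner_smul_right, real_inner_smul_right, i22, i21]; ring
  rw [hnorm] at hmain
  set c : ℝ := ⟪e₁, e₂⟫ with hcdef
  set s := √(1 - c ^ 2) with hs
  have hs0 : 0 < s := Real.sqrt_pos.2 hcc
  have hs2 : s ^ 2 = 1 - c ^ 2 := Real.sq_sqrt hcc.le
  set d₁ : E2 := (1 / (lam₂ * s ^ 2)) • (c • e₁ - e₂) with hd₁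
  set d₂ : E2 := (1 / (lam₁ * s ^ 2)) • (c • e₂ - e₁) with hd₂
  have g11 : co lam₁ e₁ d₁ = 0 := by
    rw [hd₁, co_smul, co_sub, co_smul]; simp only [co, i11, i21]; ring
  have g12 : co lam₂ e₂ d₁ = 1 := by
    rw [hd₁, co_smul, co_sub, co_smul]; simp only [co, i22, ← hcdef]
    field_simp; rw [hs2]; ring
  have g22 : co lam₂ e₂ d₂ = 0 := by
    rw [hd₂, co_smul, co_sub, co_smul]; simp only [co, i22, ← hcdef]; ring
  have g21 : co lam₁ e₁ d₂ = 1 := by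
    rw [hd₂, co_smul, co_sub, co_smul]; simp only [co, i11, i21]
    field_simp; rw [hs2]; ring
  have G : Geo C r₀ e₁ e₂ e d₁ d₂ lam₁ lam₂ :=
    { cpt := hC.1, cvx := hC.2.1, int := hC.2.2, fr := hr₀, n1 := he₁, n2 := he₂, ne := hne
      l1 := hl₁, l2 := hl₂, he := he, hn := hnorm, cone := hcone
      d11 := g11, d12 := g12, d21 := g21, d22 := g22
      exp := by
        intro v
        have h1 : co lam₁ e₁ (v - (co lam₂ e₂ v • d₁ + co lam₁ e₁ v • d₂)) = 0 := by
          rw [co_sub, co_add, co_smul _ _ d₁ _, co_smul _ _ d₂ _, g11, g21]; ring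
        have h2 : co lam₂ e₂ (v - (co lam₂ e₂ v • d₁ + co lam₁ e₁ v • d₂)) = 0 := by
          rw [co_sub, co_add, co_smul _ _ d₁ _, co_smul _ _ d₂ _, g12, g22]; ring
        apply sub_eq_zero.1
        apply hz _ he₁ he₂ hcc
        · simpa only [co, neg_eq_zero, mul_eq_zero, hl₁.ne', false_or] using h1
        · simpa only [co, neg_eq_zero, mul_eq_zero, hl₂.ne', false_or] using h2 }
  have k1 : Real.cos (angle e₁ e) = lam₁ + lam₂ * c := by
    rw [cos_angle, he₁, hnorm, c1]; ring
  have k2 : Real.cos (angle e₂ e) = lam₁ * c + lam₂ := by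
    rw [cos_angle, he₂, hnorm, c2]; ring
  have s1 : Real.sin (angle e₁ e) = lam₂ * s := by
    rw [← sq_eq_sq₀ (sin_angle_nonneg _ _) (by positivity), Real.sin_sq, k1, mul_pow, hs2]
    linear_combination hmain
  have s2 : Real.sin (angle e₂ e) = lam₁ * s := by
    rw [← sq_eq_sq₀ (sin_angle_nonneg _ _) (by positivity), Real.sin_sq, k2, mul_pow, hs2]
    linear_combination hmain
  have s3 : Real.sin (Real.pi - angle e₁ e - angle e₂ e) = s := by
    rw [sub_sub, Real.sin_pi_sub, Real.sin_add, s1, s2, k1, k2]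
    linear_combination -s * hmain
  have hD : ‖d₁ - d₂‖ = 1 / (lam₁ * lam₂ * s) := by
    have hu : ‖(lam₁ * c + lam₂) • e₁ - (lam₁ + lam₂ * c) • e₂‖ = s := by
      rw [← sq_eq_sq₀ (norm_nonneg _) hs0.le, ← real_inner_self_eq_norm_sq, hs2]
      simp only [inner_sub_left, inner_sub_right, real_inner_smul_left, real_inner_smul_right, i11,
        i22, i21, ← hcdef]
      linear_combination -(1 - c ^ 2) * hmain
    have hdd : d₁ - d₂ = (1 / (lam₁ * lam₂ * s ^ 2)) •
        ((lam₁ * c + lam₂) • e₁ - (lam₁ + lam₂ * c) • e₂) := by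
      have q1 : 1 / (lam₂ * s ^ 2) = 1 / (lam₁ * lam₂ * s ^ 2) * lam₁ := by field_simp
      have q2 : 1 / (lam₁ * s ^ 2) = 1 / (lam₁ * lam₂ * s ^ 2) * lam₂ := by field_simp
      rw [hd₁, hd₂, q1, q2]
      module
    rw [hdd, norm_smul, hu, Real.norm_of_nonneg (by positivity)]
    field_simp
  have n1 := G.normals
  have n2 := G.swap.normals
  refine ⟨fun t => Sset2 C r₀ e t ∩ {x | co lam₁ e₁ (x - r₀) ≤ co lam₂ e₂ (x - r₀)},
    fun t => Sset2 C r₀ e t ∩ {x | co lam₂ e₂ (x - r₀) < co lam₁ e₁ (x - r₀)}, ?_, ?_, ?_⟩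
  · intro t _
    constructor
    · rw [← inter_union_distrib_left]
      apply inter_eq_left.2
      intro x _
      rcases le_or_gt (co lam₁ e₁ (x - r₀)) (co lam₂ e₂ (x - r₀)) with h | h
      · exact Or.inl h
      · exact Or.inr h
    · rw [Set.disjoint_left]
      rintro x ⟨_, hx⟩ ⟨_, hx'⟩
      have h1 : co lam₁ e₁ (x - r₀) ≤ co lam₂ e₂ (x - r₀) := hx
      have h2 : co lam₂ e₂ (x - r₀) < co lam₁ e₁ (x - r₀) := hx'
      linarith
  · intro ε hε
    obtain ⟨t₁, ht₁, H1⟩ := n1 ε hε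
    obtain ⟨t₂, ht₂, H2⟩ := n2 ε hε
    refine ⟨min t₁ t₂, lt_min ht₁ ht₂, fun t ht htt => ⟨?_, ?_⟩⟩
    · rintro ξ ⟨hξ, hξ'⟩ hreg n hn
      have hh : ⟪ξ - r₀, e⟫ ≥ -t := hξ.2
      have := htt.trans_le (min_le_left _ _)
      exact H1 ξ hξ.1 (fun h => G.not_reg (h ▸ hreg)) hξ' (by linarith) n hn
    · rintro ξ ⟨hξ, hξ'⟩ hreg n hn
      have hh : ⟪ξ - r₀, e⟫ ≥ -t := hξ.2
      have := htt.trans_le (min_le_right _ _)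
      exact H2 ξ hξ.1 (fun h => G.not_reg (h ▸ hreg)) (le_of_lt hξ') (by linarith) n hn
  · have T1 := G.side (lam₂ * s) (by positivity)
      (by rw [c1, mul_pow, hs2]; linear_combination -hmain)
      (fun t => Sset2 C r₀ e t ∩ {x | co lam₁ e₁ (x - r₀) ≤ co lam₂ e₂ (x - r₀)})
      (fun t _ x hx => hx) (fun t _ x hx hx' => ⟨hx, le_of_lt hx'⟩)
    have T2 := G.swap.side (lam₁ * s) (by positivity)
      (by rw [c2, mul_pow, hs2]; linear_combination -hmain)
      (fun t => Sset2 C r₀ e t ∩ {x | co lam₂ e₂ (x - r₀) < co lam₁ e₁ (x - r₀)})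
      (fun t _ x hx => ⟨hx.1, le_of_lt hx.2⟩) (fun t _ x hx hx' => ⟨hx, hx'⟩)
    have T3 := G.chord
    refine ⟨1 / (lam₁ * lam₂ * s ^ 2), by positivity, ?_, ?_, ?_⟩
    · rw [s2]
      have := T1.div_const (lam₁ * s)
      convert this using 2
      · rw [div_div]
      · field_simp
    · rw [s1]
      have := T2.div_const (lam₂ * s)
      convert this using 2
      · rw [div_div]
      · field_simp
    · rw [s3]
      have := T3.div_const s
      rw [hD] at this
      convert this using 2
      · rw [div_div]
      · field_simp
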